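/- arXiv:1611.08345 — 7 statements merged into one kernel-verified Lean document; each statement's English description precedes it below -/
import Mathlib

section
/- Let ε₀ > 0, let k ∈ ℝ with k > 1 and k not an integer, and let I : ℝ → ℝ be C^∞. Then there exists a constant C ∈ ℝ such that ∫_ε^{ε₀} I(t) t^{−k} dt − Σ_{j=0}^{⌊k⌋−1} ( I^{(j)}(0) / (j! · (k−1−j)) ) · ε^{−(k−1−j)} converges to C as ε → 0⁺. In particular, for non-integer k > 1 the small-ε expansion contains only the divergent powers ε^{−(k−1)}, ..., ε^{−(k−⌊k⌋)} and no log ε term. -/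
open MeasureTheory Filter Topology Set

/-- Taylor's estimate at the left endpoint `0`, for a function smooth on the whole line. -/
lemma exists_abs_sub_taylor_le {I : ℝ → ℝ} (hI : ContDiff ℝ (⊤ : ℕ∞) I) {b : ℝ} (hb : 0 < b)
    (m : ℕ) :
    ∃ M, ∀ t ∈ Icc 0 b,
      |I t - ∑ j ∈ Finset.range (m + 1), iteratedDeriv j I 0 / (j.factorial : ℝ) * t ^ j|
        ≤ M * t ^ (m + 1) := by
  have hsmooth : ∀ n : ℕ, ContDiff ℝ n I := fun n ↦ hI.of_le (by exact_mod_cast le_top)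
  obtain ⟨M, hM⟩ := exists_taylor_mean_remainder_bound (n := m) hb.le
    (by exact_mod_cast (hsmooth (m + 1)).contDiffOn)
  refine ⟨M, fun t ht ↦ ?_⟩
  have h := hM t ht
  rw [taylor_within_apply, Real.norm_eq_abs, sub_zero] at h
  convert h using 4 with j
  rw [iteratedDerivWithin_eq_iteratedDeriv (uniqueDiffOn_Icc hb) (hsmooth j).contDiffAt
    (left_mem_Icc.2 hb.le), smul_eq_mul]
  ring

/-- A continuous function that is `O(t ^ n)` at `0` is integrable against `t ^ (-k)` near `0`
as soon as `k < n + 1`. -/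
lemma intervalIntegrable_div_rpow {R : ℝ → ℝ} (hR : Continuous R) {b k M : ℝ} (hb : 0 < b)
    {n : ℕ} (hk : k < n + 1) (hM : ∀ t ∈ Icc 0 b, |R t| ≤ M * t ^ n) :
    IntervalIntegrable (fun t ↦ R t / t ^ k) volume 0 b := by
  have hdom : IntervalIntegrable (fun t : ℝ ↦ M * t ^ ((n : ℝ) - k)) volume 0 b :=
    (intervalIntegral.intervalIntegrable_rpow' (by linarith)).const_mul M
  refine hdom.mono_fun' ?_ ?_
  · have : Measurable fun t ↦ R t / t ^ k := hR.measurable.div (by fun_prop)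
    exact this.aestronglyMeasurable
  · rw [uIoc_of_le hb.le]
    refine (ae_restrict_iff' measurableSet_Ioc).2 (ae_of_all _ fun t ht ↦ ?_)
    have hpos : 0 < t ^ k := Real.rpow_pos_of_pos ht.1 k
    beta_reduce
    rw [Real.norm_eq_abs, abs_div, abs_of_pos hpos, Real.rpow_sub ht.1, Real.rpow_natCast,
      ← mul_div_assoc]
    gcongr
    exact hM t ⟨ht.1.le, ht.2⟩

/-- Non-integer-`k` case of the regulated volume expansion (Theorem 2.2): for real
non-integer `k > 1` and smooth `I`, after subtracting the divergent powers
`ε^{-(k-1-j)}`, `j = 0, …, ⌊k⌋-1`, the integral `∫_ε^{ε₀} I(t) t^{-k} dt` converges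
as `ε → 0⁺`; in particular there is no `log ε` term. -/
theorem stmt1 (ε₀ : ℝ) (hε₀ : 0 < ε₀) (k : ℝ) (hk : 1 < k)
    (hknotint : ∀ n : ℤ, k ≠ (n : ℝ))
    (I : ℝ → ℝ) (hI : ContDiff ℝ (⊤ : ℕ∞) I) :
    ∃ C : ℝ, Filter.Tendsto (fun ε : ℝ =>
        (∫ t in ε..ε₀, I t / t ^ k)
        - ∑ j ∈ Finset.range ⌊k⌋₊,
            iteratedDeriv j I 0 / ((j.factorial : ℝ) * (k - 1 - (j : ℝ)))
              * ε ^ (-(k - 1 - (j : ℝ))))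
      (𝓝[>] (0:ℝ)) (𝓝 C) := by
  have hne : ∀ j : ℕ, k - 1 - (j : ℝ) ≠ 0 := fun j h ↦
    hknotint (j + 1) (by push_cast; linarith)
  have hlt : k < (⌊k⌋₊ : ℝ) + 1 := Nat.lt_floor_add_one k
  obtain ⟨m, hm⟩ : ∃ m, ⌊k⌋₊ = m + 1 :=
    Nat.exists_eq_succ_of_ne_zero (Nat.floor_pos.2 hk.le).ne'
  obtain ⟨M, hM⟩ := exists_abs_sub_taylor_le hI hε₀ m
  rw [← hm] at hM
  set n := ⌊k⌋₊
  set a : ℕ → ℝ := fun j ↦ iteratedDeriv j I 0 / (j.factorial : ℝ) with ha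
  set R : ℝ → ℝ := fun t ↦ I t - ∑ j ∈ Finset.range n, a j * t ^ j with hR
  have hRcont : Continuous R := hI.continuous.sub (by fun_prop)
  have hint : IntervalIntegrable (fun t ↦ R t / t ^ k) volume 0 ε₀ :=
    intervalIntegrable_div_rpow hRcont hε₀ hlt hM
  have hlim : Tendsto (fun ε ↦ ∫ t in ε..ε₀, R t / t ^ k) (𝓝[>] 0)
      (𝓝 (∫ t in (0 : ℝ)..ε₀, R t / t ^ k)) := by
    have hon : IntegrableOn (fun t ↦ R t / t ^ k) (uIcc 0 ε₀) := by
      rwa [uIcc_of_le hε₀.le, ← intervalIntegrable_iff_integrableOn_Icc_of_le hε₀.le]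
    have hc := intervalIntegral.continuousOn_primitive_interval_left hon
    have h0 := hc 0 left_mem_uIcc
    rw [uIcc_of_le hε₀.le] at h0
    exact h0.mono_left (nhdsWithin_le_of_mem
      (mem_of_superset (Ioo_mem_nhdsGT hε₀) Ioo_subset_Icc_self))
  refine ⟨(∫ t in (0 : ℝ)..ε₀, R t / t ^ k) - ∑ j ∈ Finset.range n,
    a j / (k - 1 - (j : ℝ)) * ε₀ ^ (-(k - 1 - (j : ℝ))), ?_⟩
  refine (hlim.sub_const _).congr' ?_
  filter_upwards [Ioo_mem_nhdsGT hε₀] with ε hε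
  have hpos : ∀ t ∈ uIcc ε ε₀, 0 < t := fun t ht ↦ by
    rw [uIcc_of_le hε.2.le] at ht
    exact hε.1.trans_le ht.1
  have h0 : (0 : ℝ) ∉ uIcc ε ε₀ := fun h ↦ (hpos 0 h).false
  have hRint : IntervalIntegrable (fun t ↦ R t / t ^ k) volume ε ε₀ :=
    hint.mono_set (by
      rw [uIcc_of_le hε.2.le, uIcc_of_le hε₀.le]
      exact Icc_subset_Icc_left hε.1.le)
  have hpint : ∀ j ∈ Finset.range n,
      IntervalIntegrable (fun t : ℝ ↦ a j * t ^ ((j : ℝ) - k)) volume ε ε₀ := fun j _ ↦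
    (intervalIntegral.intervalIntegrable_rpow (Or.inr h0)).const_mul _
  have hsplit : ∫ t in ε..ε₀, I t / t ^ k = (∫ t in ε..ε₀, R t / t ^ k)
      + ∑ j ∈ Finset.range n, ∫ t in ε..ε₀, a j * t ^ ((j : ℝ) - k) := by
    rw [← intervalIntegral.integral_finsetSum hpint,
      ← intervalIntegral.integral_add hRint (by simpa only [Finset.sum_fn] using IntervalIntegrable.sum _ hpint)]
    refine intervalIntegral.integral_congr fun t ht ↦ ?_
    have ht0 := hpos t ht
    simp only [hR, Real.rpow_sub ht0, Real.rpow_natCast, ← mul_div_assoc, ← Finset.sum_div]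
    ring
  rw [hsplit, add_sub_assoc, sub_eq_add_neg, add_right_inj, ← Finset.sum_sub_distrib,
    ← Finset.sum_neg_distrib]
  refine Finset.sum_congr rfl fun j _ ↦ ?_
  have hj := hne j
  have hexp : (j : ℝ) - k + 1 = -(k - 1 - (j : ℝ)) := by ring
  rw [intervalIntegral.integral_const_mul,
    integral_rpow (Or.inr ⟨fun h ↦ hj (by linarith), h0⟩), hexp]
  simp only [ha]
  field_simp
  ring
end

section
/- Let U ⊂ ℝ^{d−1} be a bounded open set, L > 0, let w : ℝ^{d−1} × ℝ → ℝ be C^∞, and let k ≥ 1 be an integer. Then there exist a constant C ∈ ℝ and a C^∞ function R : [0, L] → ℝ such that for every ε ∈ (0, L], ∫_U ∫_ε^L w(x,y) y^{−k} dy dx = Σ_{ℓ=1}^{k−1} ( 1/((k−1−ℓ)! · ℓ) ) ( ∫_U ∂_y^{k−1−ℓ} w(x,0) dx ) · ε^{−ℓ} − ( 1/(k−1)! ) ( ∫_U ∂_y^{k−1} w(x,0) dx ) · log ε + C + ε · R(ε). In particular the anomaly (the coefficient of log ε) and all divergent coefficients are integrals over the bottom face U × {0} of finitely many y-derivatives of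 the density w. -/
open MeasureTheory Filter Topology Set

/-- The partial derivative in the second variable of a function on `E × ℝ`. -/
noncomputable def sndDeriv {E : Type*} [NormedAddCommGroup E] [NormedSpace ℝ E]
    (w : E × ℝ → ℝ) (p : E × ℝ) : ℝ :=
  fderiv ℝ w p (0, 1)

theorem Continuous.integrableOn_of_isBounded {X : Type*} [PseudoMetricSpace X] [ProperSpace X]
    [MeasurableSpace X] [BorelSpace X] {μ : Measure X} [IsFiniteMeasureOnCompacts μ]
    {U : Set X} {f : X → ℝ} (hf : Continuous f) (hU : Bornology.IsBounded U) :
    IntegrableOn f U μ :=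
  (hf.continuousOn.integrableOn_compact' hU.isCompact_closure
    isClosed_closure.measurableSet).mono_set subset_closure

section ParametricIntegral

variable {E : Type*} [NormedAddCommGroup E] [NormedSpace ℝ E] {w : E × ℝ → ℝ}

theorem ContDiff.sndDeriv (hw : ContDiff ℝ (⊤ : ℕ∞) w) :
    ContDiff ℝ (⊤ : ℕ∞) (sndDeriv w) :=
  (hw.fderiv_right (by simp)).clm_apply contDiff_const

theorem ContDiff.hasDerivAt_sndDeriv (hw : ContDiff ℝ (⊤ : ℕ∞) w) (x : E) (y : ℝ) :
    HasDerivAt (fun y => w (x, y)) (_root_.sndDeriv w (x, y)) y := by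
  have h : HasFDerivAt w (fderiv ℝ w (x, y)) (x, y) :=
    (hw.differentiable (by simp) _).hasFDerivAt
  exact h.comp_hasDerivAt y ((hasDerivAt_const y x).prodMk (hasDerivAt_id y))

variable [ProperSpace E] [MeasurableSpace E] [BorelSpace E]
  {μ : Measure E} [IsFiniteMeasureOnCompacts μ] {U : Set E}

theorem hasDerivAt_setIntegral_of_contDiff (hU : MeasurableSet U)
    (hUb : Bornology.IsBounded U) (hw : ContDiff ℝ (⊤ : ℕ∞) w) (y : ℝ) :
    HasDerivAt (fun y => ∫ x in U, w (x, y) ∂μ) (∫ x in U, sndDeriv w (x, y) ∂μ) y := by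
  have hc : Continuous w := hw.continuous
  have hc' : Continuous (sndDeriv w) := hw.sndDeriv.continuous
  obtain ⟨B, hB⟩ := (hUb.isCompact_closure.prod
    (isCompact_closedBall y 1)).exists_bound_of_continuousOn hc'.continuousOn
  refine (hasDerivAt_integral_of_dominated_loc_of_deriv_le (bound := fun _ => B)
    (F := fun y x => w (x, y)) (F' := fun y x => sndDeriv w (x, y))
    (Metric.closedBall_mem_nhds y one_pos) ?_ ?_ ?_ ?_ ?_ ?_).2
  · exact .of_forall fun z => (Continuous.integrableOn_of_isBounded
      (by fun_prop) hUb).aestronglyMeasurable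
  · exact Continuous.integrableOn_of_isBounded (by fun_prop) hUb
  · exact (Continuous.integrableOn_of_isBounded (by fun_prop) hUb).aestronglyMeasurable
  · filter_upwards [ae_restrict_mem hU] with x hx z hz
    exact hB _ ⟨subset_closure hx, hz⟩
  · exact continuous_const.integrableOn_of_isBounded hUb
  · exact .of_forall fun x z _ => hw.hasDerivAt_sndDeriv x z

theorem contDiff_setIntegral (hU : MeasurableSet U) (hUb : Bornology.IsBounded U)
    (hw : ContDiff ℝ (⊤ : ℕ∞) w) :
    ContDiff ℝ (⊤ : ℕ∞) fun y => ∫ x in U, w (x, y) ∂μ := by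
  rw [contDiff_infty]
  intro n
  induction n generalizing w with
  | zero =>
    exact contDiff_zero.2 <| continuous_iff_continuousAt.2 fun y =>
      (hasDerivAt_setIntegral_of_contDiff hU hUb hw y).continuousAt
  | succ n ih =>
    have h := hasDerivAt_setIntegral_of_contDiff (μ := μ) hU hUb hw
    push_cast
    refine contDiff_succ_iff_deriv.2 ⟨fun y => (h y).differentiableAt, by simp, ?_⟩
    rw [funext fun y => (h y).deriv]
    exact ih hw.sndDeriv

theorem iteratedDeriv_setIntegral (hU : MeasurableSet U) (hUb : Bornology.IsBounded U)
    (hw : ContDiff ℝ (⊤ : ℕ∞) w) (n : ℕ) (y : ℝ) :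
    iteratedDeriv n (fun y => ∫ x in U, w (x, y) ∂μ) y =
      ∫ x in U, iteratedDeriv n (fun y => w (x, y)) y ∂μ := by
  induction n generalizing w with
  | zero => simp
  | succ n ih =>
    have h := hasDerivAt_setIntegral_of_contDiff (μ := μ) hU hUb hw
    simp_rw [iteratedDeriv_succ']
    rw [funext fun y => (h y).deriv, ih hw.sndDeriv]
    simp_rw [fun x => funext fun y => (hw.hasDerivAt_sndDeriv x y).deriv]

end ParametricIntegral

/-- Taylor's formula at `0` with a smooth quotient as remainder. -/
theorem ContDiff.exists_taylor_quotient {f : ℝ → ℝ} (hf : ContDiff ℝ (⊤ : ℕ∞) f) (n : ℕ) :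
    ∃ g : ℝ → ℝ, ContDiff ℝ (⊤ : ℕ∞) g ∧ ∀ y,
      f y = ∑ j ∈ Finset.range n, iteratedDeriv j f 0 / j.factorial * y ^ j + y ^ n * g y := by
  induction n generalizing f with
  | zero => exact ⟨f, hf, by simp⟩
  | succ n ih =>
    obtain ⟨g, hg, hfg⟩ := ih (contDiff_infty_iff_deriv.1 hf).2
    refine ⟨fun y => ∫ t in Ioc (0 : ℝ) 1, t ^ n * g (t * y), ?_, fun y => ?_⟩
    · exact contDiff_setIntegral (w := fun p : ℝ × ℝ => p.1 ^ n * g (p.1 * p.2))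
        measurableSet_Ioc (Metric.isBounded_Ioc 0 1) (by fun_prop)
    · have hgc := hg.continuous
      have hd : ∀ t ∈ uIcc (0 : ℝ) 1, HasDerivAt (fun t => f (t * y)) (deriv f (t * y) * y) t := by
        intro t _
        exact ((contDiff_infty_iff_deriv.1 hf).1 (t * y)).hasDerivAt.comp t
          (hasDerivAt_mul_const y)
      have hfc : Continuous (deriv f) := (contDiff_infty_iff_deriv.1 hf).2.continuous
      have key := intervalIntegral.integral_eq_sub_of_hasDerivAt hd
        (Continuous.intervalIntegrable (by fun_prop) 0 1)
      simp only [one_mul, zero_mul] at key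
      beta_reduce
      rw [← sub_add_cancel (f y) (f 0), ← key,
        ← intervalIntegral.integral_of_le zero_le_one, Finset.sum_range_succ']
      simp_rw [hfg, add_mul, Finset.sum_mul]
      rw [intervalIntegral.integral_add (Continuous.intervalIntegrable (by fun_prop) 0 1)
          (Continuous.intervalIntegrable (by fun_prop) 0 1),
        intervalIntegral.integral_finsetSum
          fun i _ => Continuous.intervalIntegrable (by fun_prop) 0 1,
        ← intervalIntegral.integral_const_mul]
      have hs : ∀ j ∈ Finset.range n,
          ∫ t in (0 : ℝ)..1, iteratedDeriv j (deriv f) 0 / j.factorial * (t * y) ^ j * y =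
            iteratedDeriv (j + 1) f 0 / (j + 1).factorial * y ^ (j + 1) := by
        intro j _
        have : ∀ t : ℝ, iteratedDeriv j (deriv f) 0 / j.factorial * (t * y) ^ j * y =
            iteratedDeriv j (deriv f) 0 / j.factorial * y ^ (j + 1) * t ^ j := fun t => by ring
        simp_rw [this]
        rw [intervalIntegral.integral_const_mul, integral_pow, iteratedDeriv_succ',
          Nat.factorial_succ]
        push_cast
        field_simp
        simp
      rw [Finset.sum_congr rfl hs]
      have hr : ∀ t : ℝ, (t * y) ^ n * g (t * y) * y = y ^ (n + 1) * (t ^ n * g (t * y)) :=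
        fun t => by ring
      simp_rw [hr]
      simp
      ring

theorem integral_one_div_pow_succ {a b : ℝ} (ha : 0 < a) (hb : 0 < b) {n : ℕ} (hn : n ≠ 0) :
    ∫ y in a..b, 1 / y ^ (n + 1) = 1 / n / a ^ n - 1 / n / b ^ n := by
  have h := integral_zpow (a := a) (b := b) (n := -(n + 1 : ℕ))
    (.inr ⟨by lia, notMem_uIcc_of_lt ha hb⟩)
  have e : -((n + 1 : ℕ) : ℤ) + 1 = -(n : ℤ) := by lia
  rw [e] at h
  simp only [zpow_neg, zpow_natCast] at h
  simp only [one_div]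
  rw [h]
  push_cast
  have : (n : ℝ) ≠ 0 := by exact_mod_cast hn
  rw [show (-((n : ℝ) + 1) + 1) = -n by ring]
  field_simp
  ring

/-- Small-`ε` expansion of `∫ y in ε..L, f y / y ^ (m + 1)` for smooth `f`. -/
theorem ContDiff.exists_expansion_integral_div_pow {f : ℝ → ℝ}
    (hf : ContDiff ℝ (⊤ : ℕ∞) f) (m : ℕ) {L : ℝ} (hL : 0 < L) :
    ∃ (C : ℝ) (R : ℝ → ℝ), ContDiff ℝ (⊤ : ℕ∞) R ∧ ∀ ε, 0 < ε →
      ∫ y in ε..L, f y / y ^ (m + 1) =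
        (∑ ℓ ∈ Finset.Icc 1 m,
          (1 / (((m - ℓ).factorial : ℝ) * (ℓ : ℝ))) * iteratedDeriv (m - ℓ) f 0 / ε ^ ℓ)
        - (1 / (m.factorial : ℝ)) * iteratedDeriv m f 0 * Real.log ε + C + ε * R ε := by
  obtain ⟨g, hg, hfg⟩ := hf.exists_taylor_quotient (m + 1)
  have hgc := hg.continuous
  have hG : ∀ y, HasDerivAt (fun y => ∫ t in (0 : ℝ)..y, g t) (g y) y := fun y =>
    intervalIntegral.integral_hasDerivAt_right (hgc.intervalIntegrable _ _)
      (hgc.stronglyMeasurableAtFilter _ _) hgc.continuousAt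
  have hGs : ContDiff ℝ (⊤ : ℕ∞) fun y => ∫ t in (0 : ℝ)..y, g t := by
    refine contDiff_infty_iff_deriv.2 ⟨fun y => (hG y).differentiableAt, ?_⟩
    rwa [funext fun y => (hG y).deriv]
  obtain ⟨R, hR, hGR⟩ := hGs.exists_taylor_quotient 1
  refine ⟨(1 / (m.factorial : ℝ)) * iteratedDeriv m f 0 * Real.log L
    - (∑ ℓ ∈ Finset.Icc 1 m,
      (1 / (((m - ℓ).factorial : ℝ) * (ℓ : ℝ))) * iteratedDeriv (m - ℓ) f 0 / L ^ ℓ)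
    + ∫ t in (0 : ℝ)..L, g t, fun y => -R y, hR.neg, fun ε hε => ?_⟩
  have h0 : ∀ y ∈ uIcc ε L, 0 < y := fun y hy => (lt_min hε hL).trans_le hy.1
  have hpt : ∀ y ∈ uIcc ε L, f y / y ^ (m + 1) =
      ((∑ ℓ ∈ Finset.Icc 1 m,
        iteratedDeriv (m - ℓ) f 0 / (m - ℓ).factorial * (1 / y ^ (ℓ + 1))) +
        iteratedDeriv m f 0 / m.factorial * (1 / y)) + g y := by
    intro y hy
    have hy0 := (h0 y hy).ne'
    have hrefl : ∑ ℓ ∈ Finset.Icc 1 m,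
        iteratedDeriv (m - ℓ) f 0 / (m - ℓ).factorial * (1 / y ^ (ℓ + 1)) =
        ∑ j ∈ Finset.range m, iteratedDeriv j f 0 / j.factorial * y ^ j / y ^ (m + 1) := by
      refine Finset.sum_bij' (fun ℓ _ => m - ℓ) (fun j _ => m - j) ?_ ?_ ?_ ?_ ?_
      · intro ℓ h; simp only [Finset.mem_Icc, Finset.mem_range] at *; lia
      · intro j h; simp only [Finset.mem_Icc, Finset.mem_range] at *; lia
      · intro ℓ h; simp only [Finset.mem_Icc] at *; lia
      · intro j h; simp only [Finset.mem_range] at *; lia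
      · intro ℓ h
        simp only [Finset.mem_Icc] at h
        have : y ^ (m + 1) = y ^ (m - ℓ) * y ^ (ℓ + 1) := by
          rw [← pow_add]; congr 1; lia
        rw [this]
        field_simp
    rw [hrefl, hfg y, Finset.sum_range_succ, ← Finset.sum_div]
    field_simp
    ring
  have hi : ∀ n : ℕ, IntervalIntegrable (fun y : ℝ => 1 / y ^ n) volume ε L := fun n =>
    (continuousOn_const.div (by fun_prop)
      fun y hy => pow_ne_zero _ (h0 y hy).ne').intervalIntegrable
  have hi1 : IntervalIntegrable (fun y : ℝ => 1 / y) volume ε L := by simpa using hi 1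
  have hs : IntervalIntegrable (fun y : ℝ => ∑ ℓ ∈ Finset.Icc 1 m,
      iteratedDeriv (m - ℓ) f 0 / (m - ℓ).factorial * (1 / y ^ (ℓ + 1))) volume ε L := by
    rw [← Finset.sum_fn]
    exact .sum _ fun ℓ _ => (hi _).const_mul _
  rw [intervalIntegral.integral_congr hpt,
    intervalIntegral.integral_add (hs.add (hi1.const_mul _)) (hgc.intervalIntegrable _ _),
    intervalIntegral.integral_add hs (hi1.const_mul _),
    intervalIntegral.integral_finsetSum fun ℓ _ => (hi _).const_mul _,
    intervalIntegral.integral_const_mul, integral_one_div_of_pos hε hL,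
    Real.log_div hL.ne' hε.ne']
  have hterm : ∀ ℓ ∈ Finset.Icc 1 m,
      ∫ y in ε..L, iteratedDeriv (m - ℓ) f 0 / (m - ℓ).factorial * (1 / y ^ (ℓ + 1)) =
        (1 / (((m - ℓ).factorial : ℝ) * (ℓ : ℝ))) * iteratedDeriv (m - ℓ) f 0 / ε ^ ℓ -
        (1 / (((m - ℓ).factorial : ℝ) * (ℓ : ℝ))) * iteratedDeriv (m - ℓ) f 0 / L ^ ℓ := by
    intro ℓ h
    have hℓ : ℓ ≠ 0 := by simp only [Finset.mem_Icc] at h; lia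
    rw [intervalIntegral.integral_const_mul, integral_one_div_pow_succ hε hL hℓ]
    have : (ℓ : ℝ) ≠ 0 := by exact_mod_cast hℓ
    field_simp
  have hsplit : ∫ y in ε..L, g y = (∫ t in (0 : ℝ)..L, g t) - ε * R ε := by
    have h1 := intervalIntegral.integral_add_adjacent_intervals
      (hgc.intervalIntegrable (μ := volume) 0 ε) (hgc.intervalIntegrable ε L)
    have h2 := hGR ε
    simp at h2
    linarith
  rw [Finset.sum_congr rfl hterm, Finset.sum_sub_distrib, hsplit]
  ring

/-- Product-chart model of the regulated volume expansion (Theorem 2.2): for a bounded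
open `U ⊂ ℝ^{d-1}`, a smooth density `w` and integer `k ≥ 1`, the regulated volume
`∫_U ∫_ε^L w(x,y) y^{-k} dy dx` expands into divergent powers of `ε` and a `log ε`
term whose coefficients are integrals over `U × {0}` of `y`-derivatives of `w`, plus a
constant and `ε · R(ε)` with `R` smooth on `[0, L]`. -/
theorem stmt2 (d : ℕ) (U : Set (EuclideanSpace ℝ (Fin (d-1)))) (hU : IsOpen U)
    (hUb : Bornology.IsBounded U) (L : ℝ) (hL : 0 < L)
    (w : EuclideanSpace ℝ (Fin (d-1)) × ℝ → ℝ) (hw : ContDiff ℝ (⊤ : ℕ∞) w)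
    (k : ℕ) (hk : 1 ≤ k) :
    ∃ (C : ℝ) (R : ℝ → ℝ), ContDiffOn ℝ (⊤ : ℕ∞) R (Set.Icc 0 L) ∧
      ∀ ε ∈ Set.Ioc (0:ℝ) L,
        (∫ x in U, ∫ y in ε..L, w (x, y) / y ^ k) =
          (∑ ℓ ∈ Finset.Icc 1 (k-1),
            (1 / (((k-1-ℓ).factorial : ℝ) * (ℓ : ℝ)))
              * (∫ x in U, iteratedDeriv (k-1-ℓ) (fun y => w (x, y)) 0) / ε ^ ℓ)
          - (1 / ((k-1).factorial : ℝ))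
              * (∫ x in U, iteratedDeriv (k-1) (fun y => w (x, y)) 0) * Real.log ε
          + C + ε * R ε := by
  obtain ⟨m, rfl⟩ : ∃ m, k = m + 1 := ⟨k - 1, by lia⟩
  obtain ⟨C, R, hR, h⟩ := (contDiff_setIntegral (μ := volume) hU.measurableSet hUb
    hw).exists_expansion_integral_div_pow m hL
  refine ⟨C, R, hR.contDiffOn, fun ε hε => ?_⟩
  have hswap : ∫ x in U, ∫ y in ε..L, w (x, y) / y ^ (m + 1) =
      ∫ y in ε..L, (∫ x in U, w (x, y)) / y ^ (m + 1) := by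
    rw [← intervalIntegral_integral_swap]
    · simp_rw [integral_div]
    · have hcont : ContinuousOn (fun p : ℝ × EuclideanSpace ℝ (Fin (d - 1)) =>
          w (p.2, p.1) / p.1 ^ (m + 1)) (uIcc ε L ×ˢ closure U) := by
        have hc := hw.continuous
        refine ContinuousOn.div (by fun_prop) (by fun_prop) fun p hp => pow_ne_zero _ ?_
        exact ((lt_min hε.1 hL).trans_le hp.1.1).ne'
      rw [Measure.prod_restrict]
      exact (hcont.integrableOn_compact
        (isCompact_uIcc.prod hUb.isCompact_closure)).mono_set
        (prod_mono uIoc_subset_uIcc subset_closure)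
  rw [hswap, h ε hε.1]
  simp_rw [iteratedDeriv_setIntegral hU.measurableSet hUb hw, Nat.add_sub_cancel]
end

section
/- Let δ > 0, let ψ : ℝ → ℝ be C^∞, let Ω : ℝ → ℝ be C^∞ with Ω > 0, and let k ≥ 1 be an integer. Define G(ε) = ∫_{{ y ∈ (0,δ) : Ω(y) y > ε }} ψ(y) y^{−k} dy. Then there exist real coefficients c_1, ..., c_{k−1} and C such that, as ε → 0⁺, G(ε) = Σ_{ℓ=1}^{k−1} c_ℓ ε^{−ℓ} − ( ψ^{(k−1)}(0)/(k−1)! ) · log ε + C + o(1). In particular the coefficient of log ε equals −ψ^{(k−1)}(0)/(k−1)! for every choice of the positive smooth function Ω. -/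
open MeasureTheory Filter Topology Set

/-- The integral of a smooth function against `t ^ (-(n + 1))` on `(y, δ)` is, up to a convergent
term as `y → 0⁺`, the sum of a pole `Q y / y ^ n` and a logarithm whose coefficient is the `n`-th
Taylor coefficient of the function. -/
theorem exists_tendsto_integral_div_pow_sub {δ : ℝ} (hδ : 0 < δ) (n : ℕ) (ψ : ℝ → ℝ)
    (hψ : ContDiff ℝ (⊤ : ℕ∞) ψ) :
    ∃ (Q : ℝ → ℝ) (B : ℝ), ContDiff ℝ (⊤ : ℕ∞) Q ∧
      Tendsto (fun y : ℝ => (∫ t in y..δ, ψ t / t ^ (n + 1)) - Q y / y ^ n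
        + iteratedDeriv n ψ 0 / (n.factorial : ℝ) * Real.log y) (𝓝[>] 0) (𝓝 B) := by
  induction n generalizing ψ with
  | zero =>
    have hcont : Continuous (dslope ψ 0) := by
      rw [← continuousOn_univ, continuousOn_dslope univ_mem]
      exact ⟨hψ.continuous.continuousOn, (hψ.differentiable (by simp)).differentiableAt⟩
    have hlim : Tendsto (fun y : ℝ => ψ 0 * Real.log δ + ∫ t in y..δ, dslope ψ 0 t) (𝓝[>] 0)
        (𝓝 (ψ 0 * Real.log δ + ∫ t in (0 : ℝ)..δ, dslope ψ 0 t)) := by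
      have h : Continuous fun y : ℝ => ∫ t in y..δ, dslope ψ 0 t := by
        simp_rw [intervalIntegral.integral_symm δ]
        exact (intervalIntegral.continuous_primitive
          (fun a b => hcont.intervalIntegrable a b) δ).neg
      exact ((continuous_const.add h).tendsto 0).mono_left nhdsWithin_le_nhds
    refine ⟨0, _, contDiff_const, hlim.congr' ?_⟩
    filter_upwards [self_mem_nhdsWithin] with y (hy : 0 < y)
    have hpos : ∀ t ∈ uIcc y δ, 0 < t := fun t ht => (lt_min hy hδ).trans_le ht.1
    have heq : ∫ t in y..δ, ψ t / t ^ (0 + 1) = ∫ t in y..δ, (ψ 0 * (1 / t) + dslope ψ 0 t) := by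
      refine intervalIntegral.integral_congr fun t ht => ?_
      have h0 := (hpos t ht).ne'
      simp only [dslope_of_ne _ h0, slope_def_field]
      field_simp
      ring
    have hinv : IntervalIntegrable (fun t : ℝ => ψ 0 * (1 / t)) volume y δ := by
      refine ContinuousOn.intervalIntegrable (continuousOn_const.mul ?_)
      exact continuousOn_const.div continuousOn_id fun t ht => (hpos t ht).ne'
    rw [heq, intervalIntegral.integral_add hinv (hcont.intervalIntegrable _ _),
      intervalIntegral.integral_const_mul, integral_one_div_of_pos hy hδ,
      Real.log_div hδ.ne' hy.ne']
    simp
    ring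
  | succ n ih =>
    have hψ' : ContDiff ℝ (⊤ : ℕ∞) (deriv ψ) := (contDiff_infty_iff_deriv.1 hψ).2
    obtain ⟨Q, B, hQ, hB⟩ := ih (deriv ψ) hψ'
    have hn : (n + 1 : ℝ) ≠ 0 := by positivity
    refine ⟨fun y => (ψ y + y * Q y) / (n + 1), _,
      (hψ.add (contDiff_id.mul hQ)).div_const _,
      ((hB.div_const (n + 1 : ℝ)).const_add (-ψ δ / ((n + 1) * δ ^ (n + 1)))).congr' ?_⟩
    filter_upwards [self_mem_nhdsWithin] with y (hy : 0 < y)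
    have hpos : ∀ t ∈ uIcc y δ, 0 < t := fun t ht => (lt_min hy hδ).trans_le ht.1
    have hquot : ∀ (f : ℝ → ℝ) (m : ℕ), Continuous f →
        IntervalIntegrable (fun t => f t / t ^ m) volume y δ := fun f m hf =>
      ContinuousOn.intervalIntegrable
        (hf.continuousOn.div (by fun_prop) fun t ht => pow_ne_zero _ (hpos t ht).ne')
    have hder : ∀ t ∈ uIcc y δ, HasDerivAt (fun t => -ψ t / ((n + 1) * t ^ (n + 1)))
        (ψ t / t ^ (n + 1 + 1) - (deriv ψ t / t ^ (n + 1)) / (n + 1)) t := by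
      intro t ht
      have h0 := (hpos t ht).ne'
      have h := ((hψ.differentiable (by simp)) t).hasDerivAt.neg.div
        ((hasDerivAt_pow (n + 1) t).const_mul (n + 1 : ℝ))
        (mul_ne_zero hn (pow_ne_zero _ h0))
      refine h.congr_deriv ?_
      simp only [Pi.neg_apply, Nat.add_sub_cancel]
      push_cast
      field_simp
      ring
    have hI := intervalIntegral.integral_eq_sub_of_hasDerivAt hder
      ((hquot ψ _ hψ.continuous).sub ((hquot _ _ hψ'.continuous).div_const _))
    rw [intervalIntegral.integral_sub (hquot ψ _ hψ.continuous)
      ((hquot _ _ hψ'.continuous).div_const _), intervalIntegral.integral_div, sub_eq_iff_eq_add]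
      at hI
    rw [hI, iteratedDeriv_succ', Nat.factorial_succ]
    push_cast
    have hf : (n.factorial : ℝ) ≠ 0 := by positivity
    field_simp
    ring

/-- Dividing a function that is `C^n` at the origin by `x ^ n` gives a polar part plus a convergent
term. -/
theorem ContDiffAt.exists_tendsto_div_pow_sub_sum {n : ℕ} {S : ℝ → ℝ} (hS : ContDiffAt ℝ n S 0) :
    ∃ (c : ℕ → ℝ) (C : ℝ), Tendsto (fun x : ℝ => S x / x ^ n - ∑ ℓ ∈ Finset.Icc 1 n, c ℓ / x ^ ℓ)
      (𝓝[>] 0) (𝓝 C) := by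
  obtain ⟨u, hu, hSu⟩ := hS.contDiffOn le_rfl (by simp)
  obtain ⟨r, hr, hru⟩ := Metric.mem_nhds_iff.1 hu
  have hT := Real.taylor_tendsto (convex_ball (0 : ℝ) r) (Metric.mem_ball_self hr)
    (hSu.mono hru)
  rw [nhdsWithin_eq_nhds.2 (Metric.ball_mem_nhds _ hr)] at hT
  set b : ℕ → ℝ := fun j => (j.factorial : ℝ)⁻¹ * iteratedDerivWithin j S (Metric.ball 0 r) 0
    with hb
  refine ⟨fun ℓ => b (n - ℓ), 0 + b n,
    ((hT.mono_left nhdsWithin_le_nhds).add_const (b n)).congr' ?_⟩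
  filter_upwards [self_mem_nhdsWithin] with x (hx : 0 < x)
  have hsum : taylorWithinEval S n (Metric.ball 0 r) 0 x =
      ((∑ ℓ ∈ Finset.Icc 1 n, b (n - ℓ) / x ^ ℓ) + b n) * x ^ n := by
    rw [taylor_within_apply, Finset.sum_range_succ, add_mul, Finset.sum_mul]
    congr 1
    · refine Finset.sum_bij' (fun j _ => n - j) (fun ℓ _ => n - ℓ) ?_ ?_ ?_ ?_ ?_
      iterate 4 grind
      intro j hj
      have hj := (Finset.mem_range.1 hj).le
      have hpow : x ^ n = x ^ j * x ^ (n - j) := by rw [← pow_add, Nat.add_sub_cancel' hj]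
      simp only [hb, Nat.sub_sub_self hj, hpow, smul_eq_mul, sub_zero]
      field_simp
    · simp only [hb, smul_eq_mul, sub_zero]
      ring
  rw [hsum]
  field_simp
  ring

theorem hasDerivAt_mul_id_zero {Ω : ℝ → ℝ} (hΩ : DifferentiableAt ℝ Ω 0) :
    HasDerivAt (fun y => Ω y * y) (Ω 0) 0 := by
  simpa using hΩ.hasDerivAt.fun_mul (hasDerivAt_id' (0 : ℝ))

/-- A smooth defining function `y ↦ Ω y * y` of the origin has a smooth local inverse. -/
theorem exists_contDiffAt_inverse_mul_id {Ω : ℝ → ℝ} (hΩ : ContDiff ℝ (⊤ : ℕ∞) Ω)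
    (hΩ0 : Ω 0 ≠ 0) :
    ∃ φ : ℝ → ℝ, ContDiffAt ℝ (⊤ : ℕ∞) φ 0 ∧ φ 0 = 0 ∧ ∀ᶠ x in 𝓝 0, Ω (φ x) * φ x = x := by
  have hc : ContDiffAt ℝ (⊤ : ℕ∞) (fun y => Ω y * y) 0 := (hΩ.mul contDiff_id).contDiffAt
  have hd := hasDerivAt_mul_id_zero (hΩ.differentiable (by simp) 0)
  have hd' : HasFDerivAt (fun y => Ω y * y)
      (ContinuousLinearEquiv.unitsEquivAut ℝ (Units.mk0 (Ω 0) hΩ0) : ℝ →L[ℝ] ℝ) 0 :=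
    hd.hasFDerivAt_equiv hΩ0
  have h0 := hc.localInverse_apply_image hd' (by simp)
  have h1 := hc.to_localInverse hd' (by simp)
  have h2 := (hc.hasStrictFDerivAt' hd' (by simp)).eventually_right_inverse
  simp only [mul_zero] at h0 h1 h2
  exact ⟨_, h1, h0, h2⟩

/-- For a positive `Ω`, small superlevel sets of `y ↦ Ω y * y` in `(0, δ)` are intervals. -/
theorem eventually_setOf_lt_mul_eq_Ioo {δ : ℝ} (hδ : 0 < δ) {Ω φ : ℝ → ℝ}
    (hΩ : ContDiff ℝ (⊤ : ℕ∞) Ω) (hΩpos : ∀ y, 0 < Ω y)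
    (hφ : Tendsto φ (𝓝[>] 0) (𝓝[>] 0)) (hinv : ∀ᶠ x in 𝓝[>] 0, Ω (φ x) * φ x = x) :
    ∀ᶠ ε in 𝓝[>] 0, {y : ℝ | y ∈ Ioo 0 δ ∧ Ω y * y > ε} = Ioo (φ ε) δ ∧ φ ε < δ := by
  have hc : ContDiff ℝ (⊤ : ℕ∞) (fun y => Ω y * y) := hΩ.mul contDiff_id
  have hd := hasDerivAt_mul_id_zero (hΩ.differentiable (by simp) 0)
  have hev : ∀ᶠ y in 𝓝 (0 : ℝ), 0 < deriv (fun y => Ω y * y) y :=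
    (hc.continuous_deriv (by simp)).continuousAt.eventually_const_lt (by
      rw [hd.deriv]; exact hΩpos 0)
  obtain ⟨r, hr, hball⟩ := Metric.eventually_nhds_iff.1 hev
  obtain ⟨a, ha0, ha⟩ := exists_between (lt_min hr hδ)
  obtain ⟨har, haδ⟩ := lt_min_iff.1 ha
  have hmono : StrictMonoOn (fun y => Ω y * y) (Icc 0 a) := by
    refine strictMonoOn_of_deriv_pos (convex_Icc 0 a) hc.continuous.continuousOn fun y hy => ?_
    rw [interior_Icc] at hy
    apply hball
    rw [Real.dist_eq, sub_zero, abs_of_pos hy.1]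
    exact hy.2.trans har
  obtain ⟨z, hz, hzmin⟩ := isCompact_Icc.exists_isMinOn (nonempty_Icc.2 haδ.le)
    hc.continuous.continuousOn
  have hm : 0 < Ω z * z := mul_pos (hΩpos z) (ha0.trans_le hz.1)
  filter_upwards [hφ (Ioo_mem_nhdsGT ha0), hinv, Ioo_mem_nhdsGT hm] with ε hφε hε hεm
  refine ⟨ext fun y => ⟨fun ⟨hy, hlt⟩ => ⟨?_, hy.2⟩, fun hy => ?_⟩, hφε.2.trans haδ⟩
  · by_contra! hle
    have h := hmono.monotoneOn ⟨hy.1.le, hle.trans hφε.2.le⟩ ⟨hφε.1.le, hφε.2.le⟩ hle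
    simp only [hε] at h
    exact hlt.not_ge h
  · refine ⟨⟨hφε.1.trans hy.1, hy.2⟩, ?_⟩
    rcases le_total y a with hya | hya
    · have h := hmono ⟨hφε.1.le, hφε.2.le⟩ ⟨(hφε.1.trans hy.1).le, hya⟩ hy.1
      simpa only [hε] using h
    · exact hεm.2.trans_le (hzmin ⟨hya, hy.2.le⟩)

/-- One-dimensional form of the claim that the anomaly depends only on the defining
density and not on the representative defining function: for
`G(ε) = ∫_{{y ∈ (0,δ) : Ω(y) y > ε}} ψ(y) y^{-k} dy`, the coefficient of `log ε` in the
small-`ε` expansion equals `-ψ^{(k-1)}(0)/(k-1)!` for every smooth positive `Ω`. -/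
theorem stmt4 (δ : ℝ) (hδ : 0 < δ) (ψ Ω : ℝ → ℝ)
    (hψ : ContDiff ℝ (⊤ : ℕ∞) ψ) (hΩ : ContDiff ℝ (⊤ : ℕ∞) Ω)
    (hΩpos : ∀ y, 0 < Ω y) (k : ℕ) (hk : 1 ≤ k) :
    ∃ (c : ℕ → ℝ) (C : ℝ), Filter.Tendsto (fun ε : ℝ =>
        (∫ y in {y : ℝ | y ∈ Set.Ioo 0 δ ∧ Ω y * y > ε}, ψ y / y ^ k)
        - (∑ ℓ ∈ Finset.Icc 1 (k-1), c ℓ / ε ^ ℓ)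
        + (iteratedDeriv (k-1) ψ 0 / ((k-1).factorial : ℝ)) * Real.log ε
        - C)
      (𝓝[>] (0:ℝ)) (𝓝 0) := by
  obtain ⟨n, rfl⟩ := Nat.exists_eq_add_of_le' hk
  simp only [Nat.add_sub_cancel]
  obtain ⟨Q, B, hQ, hB⟩ := exists_tendsto_integral_div_pow_sub hδ n ψ hψ
  obtain ⟨φ, hφ, hφ0, hinv⟩ := exists_contDiffAt_inverse_mul_id hΩ (hΩpos 0).ne'
  replace hinv : ∀ᶠ ε in 𝓝[>] 0, Ω (φ ε) * φ ε = ε := nhdsWithin_le_nhds hinv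
  have hφpos : ∀ᶠ ε in 𝓝[>] 0, 0 < φ ε := by
    filter_upwards [hinv, self_mem_nhdsWithin] with ε hε (hpos : 0 < ε)
    rw [← hε] at hpos
    exact (mul_pos_iff_of_pos_left (hΩpos _)).1 hpos
  have hφcont : Tendsto φ (𝓝[>] 0) (𝓝 0) := by
    have h := hφ.continuousAt.tendsto
    rw [hφ0] at h
    exact h.mono_left nhdsWithin_le_nhds
  have hφlim : Tendsto φ (𝓝[>] 0) (𝓝[>] 0) := tendsto_nhdsWithin_iff.2 ⟨hφcont, hφpos⟩
  have hS : ContDiffAt ℝ n (fun ε => Q (φ ε) * Ω (φ ε) ^ n) 0 :=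
    ((hQ.contDiffAt.comp 0 hφ).mul ((hΩ.contDiffAt.comp 0 hφ).pow n)).of_le
      (by exact_mod_cast le_top)
  obtain ⟨c, C, hC⟩ := hS.exists_tendsto_div_pow_sub_sum
  have hlog : Tendsto (fun ε => Real.log (Ω (φ ε))) (𝓝[>] 0) (𝓝 (Real.log (Ω 0))) :=
    ((hΩ.continuous.tendsto 0).comp hφcont).log (hΩpos 0).ne'
  refine ⟨c, _, tendsto_sub_nhds_zero_iff.2
    ((((hB.comp hφlim).add hC).add (hlog.const_mul
      (iteratedDeriv n ψ 0 / (n.factorial : ℝ)))).congr' ?_)⟩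
  filter_upwards [eventually_setOf_lt_mul_eq_Ioo hδ hΩ hΩpos hφlim hinv, hinv, hφpos]
    with ε ⟨hset, hlt⟩ hε hpos
  have hlogε : Real.log ε = Real.log (Ω (φ ε)) + Real.log (φ ε) := by
    rw [← Real.log_mul (hΩpos _).ne' hpos.ne', hε]
  have hpole : Q (φ ε) * Ω (φ ε) ^ n / ε ^ n = Q (φ ε) / φ ε ^ n := by
    have h : ε ^ n = Ω (φ ε) ^ n * φ ε ^ n := by rw [← mul_pow, hε]
    have h1 : Ω (φ ε) ^ n ≠ 0 := pow_ne_zero _ (hΩpos _).ne'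
    have h2 : φ ε ^ n ≠ 0 := pow_ne_zero _ hpos.ne'
    rw [h]
    field_simp
  rw [hset, ← integral_Ioc_eq_integral_Ioo, ← intervalIntegral.integral_of_le hlt.le, hlogε, hpole]
  simp only [Function.comp_apply]
  ring
end

section
/- Let a : [−1,1] → ℝ be continuous, L > 0 with 1 + y·a(x) > 0 on [−1,1] × [−L,L], and τ : [−1,1] → ℝ continuous with τ > 0. Then for every ε > 0 with ε·τ(x) < L for all x ∈ [−1,1], one has exactly ∫_{−1}^{1} ∫_{ε τ(x)}^{L} (1 + y a(x)) y^{−2} dy dx = (1/ε) ∫_{−1}^{1} dx/τ(x) − (log ε) ∫_{−1}^{1} a(x) dx + [ −2/L + (log L) ∫_{−1}^{1} a(x) dx − ∫_{−1}^{1} a(x) log τ(x) dx ]. In particular the anomaly is 𝒜 = −∫_{−1}^{1} a(x) dx and the renormalized volume is Vol_ren = −2/L + (log L) ∫_{−1}^{1} a − ∫_{−1}^{1} a(x) log τ(x) dx. -/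
open MeasureTheory Filter Topology Set

theorem integral_one_add_mul_div_sq {b L : ℝ} (c : ℝ) (hb : 0 < b) (hL : 0 < L) :
    ∫ y in b..L, (1 + y * c) / y ^ 2 = 1 / b - 1 / L + c * (Real.log L - Real.log b) := by
  have hne : ∀ y ∈ uIcc b L, y ≠ 0 := fun y hy =>
    ((lt_min hb hL).trans_le hy.1).ne'
  have hderiv : ∀ y ∈ uIcc b L,
      HasDerivAt (fun y => -y⁻¹ + c * Real.log y) ((1 + y * c) / y ^ 2) y := by
    intro y hy
    have hy0 := hne y hy
    have h := (hasDerivAt_inv hy0).neg.add ((Real.hasDerivAt_log hy0).const_mul c)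
    refine h.congr_deriv ?_
    field_simp
  have hint : IntervalIntegrable (fun y => (1 + y * c) / y ^ 2) volume b L :=
    (ContinuousOn.div (by fun_prop) (by fun_prop)
      fun y hy => pow_ne_zero 2 (hne y hy)).intervalIntegrable
  rw [intervalIntegral.integral_eq_sub_of_hasDerivAt hderiv hint]
  simp only [one_div]
  ring

/-- The worked example of Section 3: for the singular measure `(1 + y a(x)) dx dy / y²`
on the rectangle `[-1,1] × [-L,L]` with regulating hypersurface `y = ε τ(x)`, the
regulated volume is computed exactly; the anomaly is `-∫ a` and the renormalized volume
is `-2/L + (log L) ∫ a - ∫ a log τ`. -/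
theorem stmt6 (a τ : ℝ → ℝ) (L : ℝ) (hL : 0 < L)
    (ha : ContinuousOn a (Set.Icc (-1) 1))
    (hpos : ∀ x ∈ Set.Icc (-1:ℝ) 1, ∀ y ∈ Set.Icc (-L) L, 0 < 1 + y * a x)
    (hτ : ContinuousOn τ (Set.Icc (-1) 1))
    (hτpos : ∀ x ∈ Set.Icc (-1:ℝ) 1, 0 < τ x)
    (ε : ℝ) (hε : 0 < ε) (hεL : ∀ x ∈ Set.Icc (-1:ℝ) 1, ε * τ x < L) :
    (∫ x in (-1:ℝ)..1, ∫ y in (ε * τ x)..L, (1 + y * a x) / y ^ 2) =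
      (∫ x in (-1:ℝ)..1, 1 / τ x) / ε
      - Real.log ε * (∫ x in (-1:ℝ)..1, a x)
      + (-2 / L + Real.log L * (∫ x in (-1:ℝ)..1, a x)
          - ∫ x in (-1:ℝ)..1, a x * Real.log (τ x)) := by
  have hIcc : uIcc (-1 : ℝ) 1 = Icc (-1) 1 := uIcc_of_le (by norm_num)
  rw [← hIcc] at ha hτ hτpos
  have hinner : ∀ x ∈ uIcc (-1 : ℝ) 1, (∫ y in (ε * τ x)..L, (1 + y * a x) / y ^ 2) =
      1 / τ x / ε - 1 / L + (Real.log L - Real.log ε) * a x - a x * Real.log (τ x) := by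
    intro x hx
    have hx0 := hτpos x hx
    rw [integral_one_add_mul_div_sq _ (mul_pos hε hx0) hL, Real.log_mul hε.ne' hx0.ne']
    field_simp
    ring
  have hτi : IntervalIntegrable (fun x => 1 / τ x) volume (-1) 1 :=
    (continuousOn_const.div hτ fun x hx => (hτpos x hx).ne').intervalIntegrable
  have hai : IntervalIntegrable a volume (-1) 1 := ha.intervalIntegrable
  have hlogi : IntervalIntegrable (fun x => a x * Real.log (τ x)) volume (-1) 1 :=
    (ha.mul (hτ.log fun x hx => (hτpos x hx).ne')).intervalIntegrable
  have hconst : IntervalIntegrable (fun _ : ℝ => 1 / L) volume (-1) 1 :=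
    intervalIntegrable_const
  rw [intervalIntegral.integral_congr hinner,
    intervalIntegral.integral_sub (((hτi.div_const ε).sub hconst).add (hai.const_mul _)) hlogi,
    intervalIntegral.integral_add ((hτi.div_const ε).sub hconst) (hai.const_mul _),
    intervalIntegral.integral_sub (hτi.div_const ε) hconst,
    intervalIntegral.integral_div, intervalIntegral.integral_const_mul,
    intervalIntegral.integral_const, smul_eq_mul]
  ring
end

section
/- There exist a continuous function a : [−1,1] → ℝ with ∫_{−1}^{1} a(x) dx = 0 and a not identically zero, together with continuous positive functions τ₁, τ₂ : [−1,1] → ℝ, such that ∫_{−1}^{1} a(x) log τ₁(x) dx ≠ ∫_{−1}^{1} a(x) log τ₂(x) dx. Consequently, in the Section 3 example (singular measure (1 + y a(x)) dx dy / y² on the rectangle, with regulating hypersurface y = ε τ(x)), the anomaly vanishes while the renormalized volume still depends on the choice of regulator τ. -/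
open MeasureTheory Filter Topology Set

/-- Observation at the end of the Section 3 example: there is a continuous `a` on
`[-1,1]` with `∫ a = 0` but `a` not identically zero, and continuous positive regulators
`τ₁, τ₂` with `∫ a log τ₁ ≠ ∫ a log τ₂`; hence vanishing anomaly does not imply
regulator independence of the renormalized volume. -/
theorem stmt7 : ∃ a τ₁ τ₂ : ℝ → ℝ,
    ContinuousOn a (Set.Icc (-1) 1) ∧
    (∫ x in (-1:ℝ)..1, a x) = 0 ∧
    (∃ x ∈ Set.Icc (-1:ℝ) 1, a x ≠ 0) ∧
    ContinuousOn τ₁ (Set.Icc (-1) 1) ∧ (∀ x ∈ Set.Icc (-1:ℝ) 1, 0 < τ₁ x) ∧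
    ContinuousOn τ₂ (Set.Icc (-1) 1) ∧ (∀ x ∈ Set.Icc (-1:ℝ) 1, 0 < τ₂ x) ∧
    (∫ x in (-1:ℝ)..1, a x * Real.log (τ₁ x))
      ≠ ∫ x in (-1:ℝ)..1, a x * Real.log (τ₂ x) := by
  refine ⟨id, fun _ => 1, Real.exp, continuousOn_id, by simp, ⟨1, by norm_num, by simp⟩,
    continuousOn_const, fun _ _ => one_pos, Real.continuous_exp.continuousOn,
    fun x _ => Real.exp_pos x, ?_⟩
  have h : (∫ x in (-1:ℝ)..1, x * x) = 2 / 3 := by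
    simp only [← pow_two, integral_pow]
    norm_num
  norm_num [h]
end

section
/- Let f be a C³ real function of one variable. Then for every r > 0 (at which f is three times differentiable), ( (1 − f′(r)⁴) f′(r) ( f‴(r) + 3 f″(r)/r ) + (1 − 8 f′(r)² + 3 f′(r)⁴) f″(r)² ) / (1 + f′(r)²)^{9/2} = ( 1 / ( r √(1 + f′(r)²) ) ) · d/dr [ f′ ( f′³ + f′ − r f′² f″ + r f″ ) / (1 + f′²)³ ](r). In other words, the Q-curvature integrand of a surface of revolution x = f(r) is, up to the area-element factor, a total r-derivative. -/
open MeasureTheory Filter Topology Set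

theorem deriv_surface_primitive {p q : ℝ → ℝ} {t r : ℝ} (hp : HasDerivAt p (q r) r)
    (hq : HasDerivAt q t r) :
    deriv (fun s => p s * (p s ^ 3 + p s - s * p s ^ 2 * q s + s * q s) / (1 + p s ^ 2) ^ 3) r
      = (3 * p r * q r * (1 - p r ^ 4) + r * (1 - 8 * p r ^ 2 + 3 * p r ^ 4) * q r ^ 2
          + r * p r * t * (1 - p r ^ 4)) / (1 + p r ^ 2) ^ 4 := by
  have hid : HasDerivAt (fun s : ℝ => s) 1 r := hasDerivAt_id' r
  have hpos : (1 + p r ^ 2) ≠ 0 := by positivity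
  have hnum := hp.fun_mul ((((hp.fun_pow 3).fun_add hp).fun_sub
    ((hid.fun_mul (hp.fun_pow 2)).fun_mul hq)).fun_add (hid.fun_mul hq))
  have hden := ((hp.fun_pow 2).const_add 1).fun_pow 3
  rw [(hnum.fun_div hden (pow_ne_zero 3 hpos)).deriv]
  field_simp
  push_cast
  ring

/-- Total-derivative identity of the Section 6 example: the Q-curvature integrand of a
surface of revolution `x = f(r)` is, up to the area-element factor, a total
`r`-derivative. Here `f' = deriv f`, `f'' = iteratedDeriv 2 f`, `f''' = iteratedDeriv 3 f`. -/
theorem stmt10 (f : ℝ → ℝ) (hf : ContDiff ℝ 3 f) (r : ℝ) (hr : 0 < r) :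
    ((1 - deriv f r ^ 4) * deriv f r
        * (iteratedDeriv 3 f r + 3 * iteratedDeriv 2 f r / r)
      + (1 - 8 * deriv f r ^ 2 + 3 * deriv f r ^ 4) * iteratedDeriv 2 f r ^ 2)
      / (1 + deriv f r ^ 2) ^ ((9:ℝ)/2)
    = (1 / (r * Real.sqrt (1 + deriv f r ^ 2))) *
        deriv (fun s => deriv f s * (deriv f s ^ 3 + deriv f s
          - s * deriv f s ^ 2 * iteratedDeriv 2 f s + s * iteratedDeriv 2 f s)
          / (1 + deriv f s ^ 2) ^ 3) r := by
  have hp : HasDerivAt (deriv f) (iteratedDeriv 2 f r) r := by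
    have h := (hf.differentiable_iteratedDeriv 1 (by norm_num)) r
    rw [iteratedDeriv_succ (n := 1)]
    simpa only [iteratedDeriv_one] using h.hasDerivAt
  have hq : HasDerivAt (iteratedDeriv 2 f) (iteratedDeriv 3 f r) r := by
    have h := (hf.differentiable_iteratedDeriv 2 (by norm_num)) r
    rw [iteratedDeriv_succ (n := 2)]
    exact h.hasDerivAt
  rw [deriv_surface_primitive hp hq]
  have hpos : 0 < 1 + deriv f r ^ 2 := by positivity
  have hpow : (1 + deriv f r ^ 2) ^ ((9 : ℝ) / 2)
      = (1 + deriv f r ^ 2) ^ 4 * √(1 + deriv f r ^ 2) := by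
    rw [Real.sqrt_eq_rpow, ← Real.rpow_natCast (1 + deriv f r ^ 2) 4, ← Real.rpow_add hpos]
    norm_num
  rw [hpow]
  have hsqrt : √(1 + deriv f r ^ 2) ≠ 0 := (Real.sqrt_pos.2 hpos).ne'
  generalize √(1 + deriv f r ^ 2) = w at hsqrt ⊢
  field_simp
  ring
end

section
/- For r ≥ 0 set A(r) = −(3r² + 2)/(4(1 + r²)²) and B(r) = r²(5r² + 6)/(6(1 + r²)⁴), and for ε > 0 set ε̄(r, ε) = √(1+r²) ε + ((3r²+2)/(4(1+r²))) ε² + ((7r⁴+12r²+12)/(24 (1+r²)^{5/2})) ε³. Fix r ≥ 0 and y₀ > 0 with 1 + A(r) t + B(r) t² > 0 on (0, y₀]. Then, as ε → 0⁺, ∫_{ε̄(r,ε)}^{y₀} dy / ( y (1 + A(r) y + B(r) y²) )³ − [ 1/(2 ε² (1+r²)) + (3r²+2)/(2 ε (1+r²)^{5/2}) − (log ε) · (7r⁴ + 12r² + 12)/(8 (1+r²)⁴) ] converges to a finite limit. -/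
open MeasureTheory Filter Topology Set

/-- The remainder of `1 / (y * (1 + A * y + B * y ^ 2)) ^ 3` after removing its polar part at `0`. -/
noncomputable def polarRemainder (A B y : ℝ) : ℝ :=
  -(-3 * A * B + 3 * B ^ 2 * y + (A + B * y) ^ 3 - 9 * A * (A + B * y) ^ 2
    + 3 * (6 * A ^ 2 - 3 * B) * (A + B * y)
    + y * (-3 * A * (A + B * y) ^ 3 + 3 * (6 * A ^ 2 - 3 * B) * (A + B * y) ^ 2)
    + y ^ 2 * ((6 * A ^ 2 - 3 * B) * (A + B * y) ^ 3)) / (1 + A * y + B * y ^ 2) ^ 3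

lemma one_div_cube_eq_polar_add_polarRemainder {A B y : ℝ} (hy : y ≠ 0)
    (hQ : 1 + A * y + B * y ^ 2 ≠ 0) :
    1 / (y * (1 + A * y + B * y ^ 2)) ^ 3 =
      (1 / y ^ 3 - 3 * A / y ^ 2 + (6 * A ^ 2 - 3 * B) / y) + polarRemainder A B y := by
  unfold polarRemainder
  obtain ⟨Q, hQ'⟩ : ∃ Q, Q = 1 + A * y + B * y ^ 2 := ⟨_, rfl⟩
  rw [← hQ'] at hQ ⊢
  field_simp
  subst hQ'
  ring

lemma hasDerivAt_polar_primitive (A c : ℝ) {y : ℝ} (hy : y ≠ 0) :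
    HasDerivAt (fun y : ℝ => -(1 / (2 * y ^ 2) - 3 * A / y - c * Real.log y))
      (1 / y ^ 3 - 3 * A / y ^ 2 + c / y) y := by
  have h1 := ((hasDerivAt_pow 2 y).const_mul 2).fun_inv (by positivity)
  have h2 := (hasDerivAt_inv hy).const_mul (3 * A)
  have h3 := (Real.hasDerivAt_log hy).const_mul c
  refine (((h1.sub h2).sub h3).neg.congr_deriv ?_).congr_of_eventuallyEq (.of_forall fun z => ?_)
  · push_cast
    field_simp
    ring
  · simp [div_eq_mul_inv]

/-- Subtracting the primitive of the polar part leaves an integral with a limit at `0`. -/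
lemma exists_tendsto_integral_sub_polar {A B y₀ : ℝ} (hy₀ : 0 < y₀)
    (hpos : ∀ t ∈ Ioc (0 : ℝ) y₀, 0 < 1 + A * t + B * t ^ 2) :
    ∃ C : ℝ, Tendsto (fun e : ℝ =>
      (∫ y in e..y₀, 1 / (y * (1 + A * y + B * y ^ 2)) ^ 3)
        - (1 / (2 * e ^ 2) - 3 * A / e - (6 * A ^ 2 - 3 * B) * Real.log e))
      (𝓝[>] 0) (𝓝 C) := by
  have hQ : ∀ t ∈ Icc (0 : ℝ) y₀, 1 + A * t + B * t ^ 2 ≠ 0 := by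
    intro t ht
    rcases ht.1.eq_or_lt with rfl | h
    · simp
    · exact (hpos t ⟨h, ht.2⟩).ne'
  have hcont : ContinuousOn (polarRemainder A B) (Icc 0 y₀) := by
    unfold polarRemainder
    exact ContinuousOn.div (by fun_prop) (by fun_prop) fun t ht => pow_ne_zero 3 (hQ t ht)
  have hprim : Tendsto (fun e => ∫ y in e..y₀, polarRemainder A B y) (𝓝[>] 0)
      (𝓝 (∫ y in (0 : ℝ)..y₀, polarRemainder A B y)) := by
    have h := intervalIntegral.continuousOn_primitive_interval_left (μ := volume)
      (f := polarRemainder A B) (a := 0) (b := y₀)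
      (by rw [uIcc_of_le hy₀.le]; exact hcont.integrableOn_Icc)
    rw [uIcc_of_le hy₀.le] at h
    exact (h 0 (left_mem_Icc.2 hy₀.le)).mono_left
      ((nhdsWithin_Ioc_eq_nhdsGT hy₀).symm.le.trans (nhdsWithin_mono _ Ioc_subset_Icc_self))
  refine ⟨_, (hprim.add_const
    (-(1 / (2 * y₀ ^ 2) - 3 * A / y₀ - (6 * A ^ 2 - 3 * B) * Real.log y₀))).congr' ?_⟩
  filter_upwards [Ioc_mem_nhdsGT hy₀] with e he
  have hne : ∀ y ∈ uIcc e y₀, y ≠ 0 := fun y hy =>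
    (he.1.trans_le (uIcc_of_le he.2 ▸ hy).1).ne'
  have hsub : uIcc e y₀ ⊆ Icc 0 y₀ := by
    rw [uIcc_of_le he.2]
    exact Icc_subset_Icc_left he.1.le
  have hpolar : IntervalIntegrable
      (fun y : ℝ => 1 / y ^ 3 - 3 * A / y ^ 2 + (6 * A ^ 2 - 3 * B) / y) volume e y₀ := by
    refine ContinuousOn.intervalIntegrable ?_
    refine ((continuousOn_const.div (by fun_prop) fun y hy => pow_ne_zero 3 (hne y hy)).sub
      (continuousOn_const.div (by fun_prop) fun y hy => pow_ne_zero 2 (hne y hy))).add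
      (continuousOn_const.div (by fun_prop) hne)
  rw [intervalIntegral.integral_congr fun y hy =>
      one_div_cube_eq_polar_add_polarRemainder (hne y hy) (hQ y (hsub hy)),
    intervalIntegral.integral_add hpolar (hcont.mono hsub).intervalIntegrable,
    intervalIntegral.integral_eq_sub_of_hasDerivAt
      (fun y hy => hasDerivAt_polar_primitive A (6 * A ^ 2 - 3 * B) (hne y hy)) hpolar]
  ring

/-- The divergences of the polar primitive along the curve `e = s * ε + m * ε ^ 2 + n * ε ^ 3`. -/
lemma exists_tendsto_polar_sub_divergences {s : ℝ} (hs : 0 < s) {m n A D : ℝ} (c : ℝ)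
    (hD : m + 3 * A * s ^ 2 + D * s ^ 3 = 0) :
    ∃ C : ℝ, Tendsto (fun ε : ℝ =>
      (1 / (2 * (s * ε + m * ε ^ 2 + n * ε ^ 3) ^ 2) - 3 * A / (s * ε + m * ε ^ 2 + n * ε ^ 3)
        - c * Real.log (s * ε + m * ε ^ 2 + n * ε ^ 3))
      - (1 / (2 * ε ^ 2 * s ^ 2) + D / ε - Real.log ε * c))
      (𝓝[>] 0) (𝓝 C) := by
  let μ : ℝ → ℝ := fun ε => s + m * ε + n * ε ^ 2
  have hμ : ContinuousAt μ 0 := by fun_prop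
  have hμ0 : μ 0 = s := by simp [μ]
  let R : ℝ → ℝ := fun ε =>
    -((m + n * ε) ^ 2 + 2 * s * n + 6 * A * s ^ 2 * (m + n * ε)
      + 2 * D * s ^ 2 * (m + n * ε) * (2 * s + ε * (m + n * ε))) / (2 * μ ε ^ 2 * s ^ 2)
      - c * Real.log (μ ε)
  have hR : ContinuousAt R 0 := by
    have hne : μ 0 ≠ 0 := hμ0 ▸ hs.ne'
    refine (ContinuousAt.div (by fun_prop) (by fun_prop) ?_).sub
      (continuousAt_const.mul (hμ.log hne))
    have := hs.ne'
    positivity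
  refine ⟨R 0, (hR.tendsto.mono_left nhdsWithin_le_nhds).congr' ?_⟩
  have hμpos : ∀ᶠ ε in 𝓝[>] (0 : ℝ), 0 < μ ε :=
    nhdsWithin_le_nhds (hμ.eventually (lt_mem_nhds (hμ0 ▸ hs)))
  filter_upwards [hμpos, self_mem_nhdsWithin] with ε hε hε0
  have hε0 : 0 < ε := hε0
  have hfac : s * ε + m * ε ^ 2 + n * ε ^ 3 = ε * μ ε := by simp only [μ]; ring
  rw [hfac, Real.log_mul hε0.ne' hε.ne']
  have key : -((m + n * ε) ^ 2 + 2 * s * n + 6 * A * s ^ 2 * (m + n * ε)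
      + 2 * D * s ^ 2 * (m + n * ε) * (2 * s + ε * (m + n * ε))) / (2 * μ ε ^ 2 * s ^ 2) =
      1 / (2 * (ε * μ ε) ^ 2) - 3 * A / (ε * μ ε) - (1 / (2 * ε ^ 2 * s ^ 2) + D / ε) := by
    field_simp
    simp only [μ]
    linear_combination (2 * s * ε) * hD
  simp only [R]
  rw [key]
  ring

lemma tendsto_cubic_nhdsGT_zero {s : ℝ} (hs : 0 < s) (m n : ℝ) :
    Tendsto (fun ε : ℝ => s * ε + m * ε ^ 2 + n * ε ^ 3) (𝓝[>] 0) (𝓝[>] 0) := by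
  refine tendsto_nhdsWithin_iff.2 ⟨?_, ?_⟩
  · have h : ContinuousAt (fun ε : ℝ => s * ε + m * ε ^ 2 + n * ε ^ 3) 0 := by fun_prop
    simpa using h.tendsto.mono_left (nhdsWithin_le_nhds (s := Ioi 0))
  · have h : ContinuousAt (fun ε : ℝ => s + m * ε + n * ε ^ 2) 0 := by fun_prop
    have hpos : ∀ᶠ ε in 𝓝[>] (0 : ℝ), 0 < s + m * ε + n * ε ^ 2 :=
      nhdsWithin_le_nhds (h.eventually (lt_mem_nhds (by simpa using hs)))
    filter_upwards [hpos, self_mem_nhdsWithin] with ε h1 h2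
    have : 0 < ε * (s + m * ε + n * ε ^ 2) := mul_pos h2 h1
    simp only [mem_Ioi]
    linarith

/-- Key asymptotic computation of the singular Yamabe paraboloid example (Section 7):
with `A(r) = -(3r²+2)/(4(1+r²)²)`, `B(r) = r²(5r²+6)/(6(1+r²)⁴)` and lower terminal
`ε̄(r,ε) = √(1+r²) ε + ((3r²+2)/(4(1+r²))) ε² + ((7r⁴+12r²+12)/(24(1+r²)^{5/2})) ε³`,
the inner integral minus its divergent and `log ε` parts converges as `ε → 0⁺`. -/
theorem stmt12 (r : ℝ) (hr : 0 ≤ r) (y₀ : ℝ) (hy₀ : 0 < y₀)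
    (hpos : ∀ t ∈ Set.Ioc (0:ℝ) y₀,
      0 < 1 + (-(3 * r ^ 2 + 2) / (4 * (1 + r ^ 2) ^ 2)) * t
            + (r ^ 2 * (5 * r ^ 2 + 6) / (6 * (1 + r ^ 2) ^ 4)) * t ^ 2) :
    ∃ C : ℝ, Filter.Tendsto (fun ε : ℝ =>
        (∫ y in (Real.sqrt (1 + r ^ 2) * ε
              + ((3 * r ^ 2 + 2) / (4 * (1 + r ^ 2))) * ε ^ 2
              + ((7 * r ^ 4 + 12 * r ^ 2 + 12)
                  / (24 * (1 + r ^ 2) ^ ((5:ℝ)/2))) * ε ^ 3)..y₀,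
            1 / (y * (1 + (-(3 * r ^ 2 + 2) / (4 * (1 + r ^ 2) ^ 2)) * y
              + (r ^ 2 * (5 * r ^ 2 + 6) / (6 * (1 + r ^ 2) ^ 4)) * y ^ 2)) ^ 3)
        - (1 / (2 * ε ^ 2 * (1 + r ^ 2))
            + (3 * r ^ 2 + 2) / (2 * ε * (1 + r ^ 2) ^ ((5:ℝ)/2))
            - Real.log ε * (7 * r ^ 4 + 12 * r ^ 2 + 12) / (8 * (1 + r ^ 2) ^ 4)))
      (𝓝[>] (0:ℝ)) (𝓝 C) := by
  have hq : 0 < 1 + r ^ 2 := by positivity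
  have hs : 0 < Real.sqrt (1 + r ^ 2) := Real.sqrt_pos.2 hq
  have hs2 : Real.sqrt (1 + r ^ 2) ^ 2 = 1 + r ^ 2 := Real.sq_sqrt hq.le
  have hpow : (1 + r ^ 2) ^ ((5 : ℝ) / 2) = Real.sqrt (1 + r ^ 2) ^ 5 := by
    rw [Real.sqrt_eq_rpow, ← Real.rpow_mul_natCast hq.le]
    norm_num
  have hD : (3 * r ^ 2 + 2) / (4 * (1 + r ^ 2))
      + 3 * (-(3 * r ^ 2 + 2) / (4 * (1 + r ^ 2) ^ 2)) * Real.sqrt (1 + r ^ 2) ^ 2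
      + (3 * r ^ 2 + 2) / (2 * (1 + r ^ 2) ^ ((5 : ℝ) / 2)) * Real.sqrt (1 + r ^ 2) ^ 3 = 0 := by
    have h5 : (3 * r ^ 2 + 2) / (2 * (1 + r ^ 2) ^ ((5 : ℝ) / 2)) * Real.sqrt (1 + r ^ 2) ^ 3
        = (3 * r ^ 2 + 2) / (2 * Real.sqrt (1 + r ^ 2) ^ 2) := by
      rw [hpow]
      field_simp
    rw [h5, hs2]
    field_simp
    ring
  obtain ⟨C₁, h₁⟩ := exists_tendsto_integral_sub_polar hy₀ hpos
  obtain ⟨C₂, h₂⟩ := exists_tendsto_polar_sub_divergences hs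
    (n := (7 * r ^ 4 + 12 * r ^ 2 + 12) / (24 * (1 + r ^ 2) ^ ((5 : ℝ) / 2)))
    ((7 * r ^ 4 + 12 * r ^ 2 + 12) / (8 * (1 + r ^ 2) ^ 4)) hD
  have hc : 6 * (-(3 * r ^ 2 + 2) / (4 * (1 + r ^ 2) ^ 2)) ^ 2
      - 3 * (r ^ 2 * (5 * r ^ 2 + 6) / (6 * (1 + r ^ 2) ^ 4))
      = (7 * r ^ 4 + 12 * r ^ 2 + 12) / (8 * (1 + r ^ 2) ^ 4) := by
    field_simp
    ring
  rw [hc] at h₁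
  refine ⟨C₁ + C₂, ((h₁.comp (tendsto_cubic_nhdsGT_zero hs
    ((3 * r ^ 2 + 2) / (4 * (1 + r ^ 2)))
    ((7 * r ^ 4 + 12 * r ^ 2 + 12) / (24 * (1 + r ^ 2) ^ ((5 : ℝ) / 2))))).add h₂).congr
    fun ε => ?_⟩
  have hdiv : (3 * r ^ 2 + 2) / (2 * ε * (1 + r ^ 2) ^ ((5 : ℝ) / 2))
      = (3 * r ^ 2 + 2) / (2 * (1 + r ^ 2) ^ ((5 : ℝ) / 2)) / ε := by
    rw [div_div]
    congr 1
    ring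
  simp only [Function.comp_apply]
  rw [hs2, hdiv, mul_div_assoc' (Real.log ε), sub_add_sub_cancel]
end
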